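/- arXiv:2403.02937 — 4 statements merged into one kernel-verified Lean document; each statement's English description precedes it below -/
import Mathlib

section
/- Let m, M, N be natural numbers with 1 ≤ m ≤ M and N ≥ 1, and let U₁, …, U_m be linear operators on the space of functions Fin N → ℂ. For each i define the linear operator W_i on functions F : Fin N × (ℤ/Mℤ) → ℂ by (W_i F)(x, j) = (U_i (F(·, 0)))(x) if j = 1 (in ℤ/Mℤ) and (W_i F)(x, j) = F(x, j − 1) otherwise; that is, W_i applies U_i controlled on the counter register being 0 and then increments the counter by 1 modulo M. For ψ : Fin N → ℂ let Ψ : Fin N × (ℤ/Mℤ) → ℂ be defined by Ψ(x, 0) = ψ(x) and Ψ(x, j) = 0 for j ≠ 0. Then ∑_{σ ∈ S_m} (W_{σ⁻¹(m)} ∘ W_{σ⁻¹(m−1)} ∘ ⋯ ∘ W_{σ⁻¹(1)})(Ψ) is the function taking value (m−1)! · (∑_{i=1}^{m} U_i ψ)(x) at (x, m mod M) and 0 at every (x, j) with j ≠ m mod M. -/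
/-- The joint state with main register `φ` and classical counter value `k`. -/
def counterState {α K R : Type*} [DecidableEq K] [Zero R] (k : K) (φ : α → R) : α × K → R :=
  fun p => if p.2 = k then φ p.1 else 0

/-- Increments that do not fire on a nonzero counter leave the main register unchanged, as long as
the counter does not wrap around. -/
theorem foldl_counterState {α R : Type*} [Zero R] {M : ℕ}
    (L : List ((α × ZMod M → R) → (α × ZMod M → R)))
    (hL : ∀ g ∈ L, ∀ (k : ZMod M) (φ : α → R), k ≠ 0 →
      g (counterState k φ) = counterState (k + 1) φ)
    (k : ℕ) (hk : 1 ≤ k) (hkM : k + L.length ≤ M) (φ : α → R) :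
    L.foldl (fun F g => g F) (counterState (k : ZMod M) φ)
      = counterState ((k + L.length : ℕ) : ZMod M) φ := by
  induction L generalizing k with
  | nil => simp
  | cons g L ih =>
    rw [List.length_cons] at hkM
    have hk0 : (k : ZMod M) ≠ 0 := by
      rw [Ne, ZMod.natCast_eq_zero_iff]
      exact Nat.not_dvd_of_pos_of_lt hk (by omega)
    rw [List.foldl_cons, hL g (by simp) _ _ hk0, ← Nat.cast_succ,
      ih (fun g' h => hL g' (List.mem_cons_of_mem _ h)) (k + 1) (by omega) (by omega),
      List.length_cons]
    congr 2
    omega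

/-- Each value is taken at `0` by exactly `n !` permutations of `Fin (n + 1)`. -/
theorem sum_perm_symm_apply_zero {A : Type*} [AddCommMonoid A] (n : ℕ) (f : Fin (n + 1) → A) :
    ∑ σ : Equiv.Perm (Fin (n + 1)), f (σ.symm 0) = n.factorial • ∑ i, f i := by
  rw [← Equiv.sum_comp (Equiv.inv (Equiv.Perm (Fin (n + 1)))),
    ← Equiv.sum_comp Equiv.Perm.decomposeFin.symm, Fintype.sum_prod_type, Finset.smul_sum]
  refine Finset.sum_congr rfl fun i _ => ?_
  have h (τ : Equiv.Perm (Fin n)) :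
      ((Equiv.inv _) (Equiv.Perm.decomposeFin.symm (i, τ))).symm 0 = i :=
    Equiv.Perm.decomposeFin_symm_apply_zero i τ
  simp_rw [h]
  simp [Fintype.card_perm]

/-- Choice interference from order interference: summing, over all `m!` execution
orders `σ`, the compositions `W_{σ⁻¹(m)} ∘ ⋯ ∘ W_{σ⁻¹(1)}` of the modified
(control-on-counter-zero, then increment) operators applied to `Ψ = ψ ⊗ |0⟩`
yields `(m−1)! · (∑ i, U_i ψ)` on the main register, tensored with the classical
counter value `m mod M`. -/
theorem order_to_choice_interference (m M N : ℕ) (hm : 1 ≤ m) (hmM : m ≤ M) (hN : 1 ≤ N)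
    (U : Fin m → (Fin N → ℂ) →ₗ[ℂ] (Fin N → ℂ))
    (W : Fin m → ((Fin N × ZMod M → ℂ) → (Fin N × ZMod M → ℂ)))
    (hW : ∀ i F x (j : ZMod M),
      W i F (x, j) = if j = 1 then U i (fun x' => F (x', 0)) x else F (x, j - 1))
    (ψ : Fin N → ℂ) (Ψ : Fin N × ZMod M → ℂ)
    (hΨ : ∀ x (j : ZMod M), Ψ (x, j) = if j = 0 then ψ x else 0) :
    (∑ σ : Equiv.Perm (Fin m),
        (List.ofFn fun i : Fin m => W (σ.symm i)).foldl (fun F g => g F) Ψ)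
      = fun p : Fin N × ZMod M =>
          if p.2 = (m : ZMod M) then ((m - 1).factorial : ℂ) * (∑ i, U i ψ) p.1 else 0 := by
  have step (i : Fin m) (k : ZMod M) (φ : Fin N → ℂ) (hk : k ≠ 0) :
      W i (counterState k φ) = counterState (k + 1) φ := by
    funext ⟨x, j⟩
    rw [hW]
    by_cases hj : j = 1
    · have h0 : (fun x' : Fin N => counterState k φ (x', 0)) = 0 := by
        funext x'
        simp [counterState, hk.symm]
      rw [if_pos hj, h0, map_zero]
      simp [counterState, hj, hk]
    · simp [counterState, hj, sub_eq_iff_eq_add]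
  have fire (i : Fin m) : W i Ψ = counterState ((1 : ℕ) : ZMod M) (U i ψ) := by
    funext ⟨x, j⟩
    rw [hW]
    by_cases hj : j = 1
    · simp [counterState, hj, hΨ]
    · simp [counterState, hj, hΨ, sub_eq_zero]
  obtain ⟨n, rfl⟩ : ∃ n, m = n + 1 := ⟨m - 1, by omega⟩
  have run (σ : Equiv.Perm (Fin (n + 1))) :
      (List.ofFn fun i => W (σ.symm i)).foldl (fun F g => g F) Ψ
        = counterState ((n + 1 : ℕ) : ZMod M) (U (σ.symm 0) ψ) := by
    rw [List.ofFn_succ, List.foldl_cons, fire, foldl_counterState _ _ 1 le_rfl]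
    · rw [List.length_ofFn, add_comm]
    · rw [List.length_ofFn]
      omega
    · intro g hg
      obtain ⟨i, rfl⟩ := (List.mem_ofFn' _ _).1 hg
      exact step _
  rw [Finset.sum_congr rfl fun σ _ => run σ,
    sum_perm_symm_apply_zero n fun i => counterState ((n + 1 : ℕ) : ZMod M) (U i ψ)]
  funext ⟨x, j⟩
  by_cases hj : j = ((n + 1 : ℕ) : ZMod M)
  · simp only [Pi.smul_apply, Finset.sum_apply, counterState, if_pos hj, nsmul_eq_mul,
      Nat.add_sub_cancel]
  · simp only [Pi.smul_apply, Finset.sum_apply, counterState, if_neg hj, Finset.sum_const_zero,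
      smul_zero]
end

section
/- Let n ≥ 1 be a natural number and let Φ be the Fisher–Yates map from ∏_{i=1}^{n} {1, …, i} to S_n, where Φ(r) is the permutation obtained by performing, in order for i = n, n−1, …, 2, the transposition exchanging positions i and r_i. Then the pushforward under Φ of the uniform probability distribution on ∏_{i=1}^{n} {1, …, i} is the uniform probability distribution on S_n. -/
/-- The Fisher–Yates map: given `r` assigning to each position `i` (0-indexed,
corresponding to `i+1 ∈ {1,…,n}`) a value `r i ∈ {0,…,i}` (corresponding to
`{1,…,i+1}`), perform, in order for `i = n−1, n−2, …, 0`, the transposition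
exchanging positions `i` and `r i`, starting from the identity arrangement. -/
def fisherYates (n : ℕ) (r : (i : Fin n) → Fin (i.val + 1)) : Equiv.Perm (Fin n) :=
  ((List.finRange n).reverse).foldl
    (fun π i => π * Equiv.swap i (Fin.castLE i.isLt (r i))) 1

/-- Swaps at positions below `j` do not affect the value at `j`. -/
theorem foldl_mul_swap_apply_of_lt {n : ℕ} (r : (i : Fin n) → Fin (i.val + 1)) (j : Fin n)
    (l : List (Fin n)) (hl : ∀ i ∈ l, i < j) (π : Equiv.Perm (Fin n)) :
    l.foldl (fun π i => π * Equiv.swap i (Fin.castLE i.isLt (r i))) π j = π j := by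
  induction l generalizing π with
  | nil => rfl
  | cons i l ih =>
    have hij : i < j := hl i List.mem_cons_self
    have hr : Fin.castLE i.isLt (r i) < j :=
      lt_of_le_of_lt (Fin.le_def.2 (Nat.le_of_lt_succ (r i).isLt)) hij
    rw [List.foldl_cons, ih fun k hk => hl k (List.mem_cons_of_mem i hk), Equiv.Perm.mul_apply,
      Equiv.swap_apply_of_ne_of_ne hij.ne' hr.ne']

/-- A product of swaps along a decreasing list of positions determines the swap targets. -/
theorem eq_of_foldl_mul_swap_eq {n : ℕ} (r s : (i : Fin n) → Fin (i.val + 1))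
    (l : List (Fin n)) (hl : l.Pairwise (· > ·)) (π : Equiv.Perm (Fin n))
    (h : l.foldl (fun π i => π * Equiv.swap i (Fin.castLE i.isLt (r i))) π =
      l.foldl (fun π i => π * Equiv.swap i (Fin.castLE i.isLt (s i))) π) :
    ∀ i ∈ l, r i = s i := by
  induction l generalizing π with
  | nil => simp
  | cons i l ih =>
    obtain ⟨hi, hl⟩ := List.pairwise_cons.1 hl
    rw [List.foldl_cons, List.foldl_cons] at h
    have hrs : r i = s i := by
      have hval := congrArg (fun σ : Equiv.Perm (Fin n) => σ i) h
      simp only [foldl_mul_swap_apply_of_lt _ i l hi, Equiv.Perm.mul_apply,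
        Equiv.swap_apply_left] at hval
      exact Fin.castLE_injective _ (π.injective hval)
    rw [hrs] at h
    exact List.forall_mem_cons.2 ⟨hrs, ih hl _ h⟩

theorem fisherYates_injective (n : ℕ) : Function.Injective (fisherYates n) := by
  intro r s h
  funext i
  exact eq_of_foldl_mul_swap_eq r s _
    (List.pairwise_reverse.2 (List.sortedLT_finRange n).pairwise) 1 h i
    (List.mem_reverse.2 (List.mem_finRange i))

theorem fisherYates_bijective (n : ℕ) : Function.Bijective (fisherYates n) := by
  refine (Fintype.bijective_iff_injective_and_card _).2 ⟨fisherYates_injective n, ?_⟩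
  simp only [Fintype.card_pi, Fintype.card_fin, Fintype.card_perm]
  rw [Fin.prod_univ_eq_prod_range (fun i => i + 1) n, Finset.prod_range_add_one_eq_factorial]

/-- A bijection between finite types preserves the uniform distribution. -/
theorem PMF.map_uniformOfFintype_of_bijective {α β : Type*} [Fintype α] [Nonempty α]
    [Fintype β] [Nonempty β] {f : α → β} (hf : Function.Bijective f) :
    PMF.map f (PMF.uniformOfFintype α) = PMF.uniformOfFintype β := by
  ext b
  obtain ⟨a, rfl⟩ := hf.2 b
  rw [PMF.map_apply, tsum_eq_single a fun a' ha' => if_neg fun h => ha' (hf.1 h).symm]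
  simp [Fintype.card_of_bijective hf]

/-- The pushforward of the uniform distribution on `∏_{i=1}^{n} {1,…,i}` under the
Fisher–Yates map is the uniform distribution on `S_n`. -/
theorem fisherYates_uniform (n : ℕ) (hn : 1 ≤ n) :
    PMF.map (fisherYates n)
        (PMF.uniformOfFintype ((i : Fin n) → Fin (i.val + 1)))
      = PMF.uniformOfFintype (Equiv.Perm (Fin n)) := by
  exact PMF.map_uniformOfFintype_of_bijective (fisherYates_bijective n)
end

section
/- Let n ≥ 1, let L be an additive subgroup of ℝⁿ equipped with the Euclidean norm, let t ∈ ℝⁿ and let r ≥ 0 be a real number such that the infimum distance from t to L is strictly greater than 2r, and let δ ∈ [0, 1]. Let V be a random vector taking values in L and let U be a random vector, independent of V, with Pr[‖U‖ ≤ r] ≥ 1 − δ (both with countable support). Then the total variation distance between the law of V + U and the law of V + U + t is at least 1 − 2δ. -/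
/-- The family of terms of the convolution of two nonnegative summable functions is summable. -/
theorem summable_convolution_terms {G : Type*} [AddGroup G] {V W : G → ℝ}
    (hV0 : ∀ x, 0 ≤ V x) (hW0 : ∀ x, 0 ≤ W x) (hV : Summable V) (hW : Summable W) :
    Summable fun p : G × G => V p.2 * W (p.1 - p.2) := by
  let e : G × G ≃ G × G :=
    (Equiv.prodComm G G).trans (Equiv.prodShear (Equiv.refl G) fun x => Equiv.subRight x)
  exact e.summable_iff.mpr (hV.mul_of_nonneg hW hV0 hW0)

/-- The total mass of a convolution is the product of the total masses. -/
theorem hasSum_convolution {G : Type*} [AddGroup G] {V W : G → ℝ}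
    (hV0 : ∀ x, 0 ≤ V x) (hW0 : ∀ x, 0 ≤ W x) (hV : Summable V) (hW : Summable W) :
    HasSum (fun z => ∑' x, V x * W (z - x)) ((∑' x, V x) * ∑' y, W y) := by
  let e : G × G ≃ G × G :=
    (Equiv.prodComm G G).trans (Equiv.prodShear (Equiv.refl G) fun x => Equiv.subRight x)
  have hVW := hV.mul_of_nonneg hW hV0 hW0
  have h : HasSum (fun p : G × G => V p.2 * W (p.1 - p.2)) ((∑' x, V x) * ∑' y, W y) :=
    e.hasSum_iff.mpr (hV.hasSum.mul hW.hasSum hVW)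
  exact h.prod_fiberwise fun z =>
    ((summable_convolution_terms hV0 hW0 hV hW).prod_factor z).hasSum

/-- A nonzero convolution value comes from a nonzero term. -/
theorem exists_ne_zero_of_convolution_ne_zero {G : Type*} [AddGroup G] {V W : G → ℝ} {z : G}
    (h : ∑' x, V x * W (z - x) ≠ 0) : ∃ x, V x ≠ 0 ∧ W (z - x) ≠ 0 := by
  by_contra! hne
  refine h ?_
  rw [← tsum_zero (α := ℝ) (β := G)]
  refine tsum_congr fun x => ?_
  by_cases hx : V x = 0
  · simp [hx]
  · simp [hne x hx]

/-- If `t` is farther than `2r` from the subgroup `L`, then the radius-`r` neighbourhoods of `L`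
and `L + t` are disjoint. -/
theorem notMem_both_neighborhoods {E : Type*} [SeminormedAddCommGroup E] {L : AddSubgroup E}
    {t z x y : E} {r : ℝ} (hfar : 2 * r < Metric.infDist t (L : Set E))
    (hx : x ∈ L) (hy : y ∈ L) (hzx : ‖z - x‖ ≤ r) : ¬ ‖z - t - y‖ ≤ r := by
  intro hzy
  have h1 : Metric.infDist t (L : Set E) ≤ dist t (x - y) :=
    Metric.infDist_le_dist_of_mem (L.sub_mem hx hy)
  have h2 : t - (x - y) = (z - x) - (z - t - y) := by abel
  rw [dist_eq_norm, h2] at h1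
  linarith [norm_sub_le (z - x) (z - t - y)]


/-- Distributional soundness of the `GapCVP` reduction: if `t` is farther than
`2r` from the subgroup `L`, `V` is a (discrete) random vector supported in `L`,
and `U` is an independent noise vector with `Pr[‖U‖ ≤ r] ≥ 1 − δ`, then the total
variation distance between the laws of `V + U` and `V + U + t` is at least
`1 − 2δ`. The laws are given by mass functions, and the law of the independent sum
is the convolution `z ↦ ∑ₓ V(x) · U(z − x)`. -/
theorem gapcvp_soundness_distributional (n : ℕ) (hn : 1 ≤ n)
    (L : AddSubgroup (EuclideanSpace ℝ (Fin n))) (t : EuclideanSpace ℝ (Fin n))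
    (r : ℝ) (hr : 0 ≤ r) (δ : ℝ) (hδ : δ ∈ Set.Icc (0 : ℝ) 1)
    (hfar : 2 * r < Metric.infDist t (L : Set (EuclideanSpace ℝ (Fin n))))
    (V U : EuclideanSpace ℝ (Fin n) → ℝ)
    (hV0 : ∀ x, 0 ≤ V x) (hV1 : ∑' x, V x = 1)
    (hVL : ∀ x, V x ≠ 0 → x ∈ L)
    (hU0 : ∀ x, 0 ≤ U x) (hU1 : ∑' x, U x = 1)
    (hUr : 1 - δ ≤ ∑' x : {y : EuclideanSpace ℝ (Fin n) // ‖y‖ ≤ r}, U x) :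
    1 - 2 * δ ≤ (1 / 2) * ∑' z : EuclideanSpace ℝ (Fin n),
        |(∑' x, V x * U (z - x)) - (∑' x, V x * U ((z - t) - x))| := by
  have hV : Summable V := by
    by_contra h
    simp [tsum_eq_zero_of_not_summable h] at hV1
  have hU : Summable U := by
    by_contra h
    simp [tsum_eq_zero_of_not_summable h] at hU1
  set B : Set (EuclideanSpace ℝ (Fin n)) := {y | ‖y‖ ≤ r}
  set W := B.indicator U
  have hW0 : ∀ x, 0 ≤ W x := Set.indicator_nonneg fun x _ => hU0 x
  have hWU : ∀ x, W x ≤ U x := Set.indicator_le_self' fun x _ => hU0 x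
  have hW : Summable W := hU.indicator B
  have hWr : 1 - δ ≤ ∑' x, W x := hUr.trans_eq (tsum_subtype B U)
  set C := fun z => ∑' x, V x * U (z - x)
  set D := fun z => ∑' x, V x * W (z - x)
  have hC : HasSum C 1 := by
    simpa [hV1, hU1] using hasSum_convolution hV0 hU0 hV hU
  have hD : HasSum D (∑' x, W x) := by
    simpa [hV1] using hasSum_convolution hV0 hW0 hV hW
  have hDC : ∀ z, D z ≤ C z := fun z =>
    Summable.tsum_le_tsum (fun x => mul_le_mul_of_nonneg_left (hWU _) (hV0 x))
      ((summable_convolution_terms hV0 hW0 hV hW).prod_factor z)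
      ((summable_convolution_terms hV0 hU0 hV hU).prod_factor z)
  have hCt : HasSum (fun z => C (z - t)) 1 := (Equiv.subRight t).hasSum_iff.mpr hC
  have hDt : HasSum (fun z => D (z - t)) (∑' x, W x) := (Equiv.subRight t).hasSum_iff.mpr hD
  have hdisj : ∀ z, D z = 0 ∨ D (z - t) = 0 := by
    intro z
    by_contra! h
    obtain ⟨x, hx, hzx⟩ := exists_ne_zero_of_convolution_ne_zero h.1
    obtain ⟨y, hy, hzy⟩ := exists_ne_zero_of_convolution_ne_zero h.2
    have hxB : z - x ∈ B := Set.mem_of_indicator_ne_zero hzx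
    have hyB : z - t - y ∈ B := Set.mem_of_indicator_ne_zero hzy
    exact notMem_both_neighborhoods hfar (hVL x hx) (hVL y hy) hxB hyB
  have hpoint : ∀ z, 2 * D z + 2 * D (z - t) - (C z + C (z - t)) ≤ |C z - C (z - t)| := by
    intro z
    have h1 := hDC z
    have h2 := hDC (z - t)
    rcases hdisj z with h | h
    · linarith [neg_abs_le (C z - C (z - t))]
    · linarith [le_abs_self (C z - C (z - t))]
  have hsum := hasSum_le hpoint (((hD.mul_left 2).add (hDt.mul_left 2)).sub (hC.add hCt))
    (hC.summable.sub hCt.summable).abs.hasSum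
  change 1 - 2 * δ ≤ (1 / 2) * ∑' z, |C z - C (z - t)|
  linarith
end

section
/- Let n, N be natural numbers with n ≥ 1 and N ≥ 1, and let c ∈ ℤⁿ satisfy |c_i| ≤ 2N for every coordinate i. Let μ be the uniform probability distribution on the box {−N, −N+1, …, N−1}ⁿ ⊆ ℤⁿ. Then ‖μ − (μ + c)‖_TV ≤ (∑_{i=1}^{n} |c_i|) / (2N). -/
/-- The uniform probability mass function on the box `{−N,…,N−1}ⁿ ⊆ ℤⁿ`. -/
noncomputable def boxPdf (n N : ℕ) (x : Fin n → ℤ) : ℝ :=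
  if ∀ i, -(N : ℤ) ≤ x i ∧ x i < (N : ℤ) then 1 / ((2 * N : ℝ)) ^ n else 0

/-- The Weierstrass product inequality. -/
theorem one_sub_sum_le_prod_one_sub_of_mem_unitInterval {ι : Type*} (s : Finset ι) (a : ι → ℝ)
    (h0 : ∀ i ∈ s, 0 ≤ a i) (h1 : ∀ i ∈ s, a i ≤ 1) :
    1 - ∑ i ∈ s, a i ≤ ∏ i ∈ s, (1 - a i) := by
  classical
  induction s using Finset.induction_on with
  | empty => simp
  | insert i s hi ih =>
    rw [Finset.sum_insert hi, Finset.prod_insert hi]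
    have ih' := ih (fun j hj => h0 j (Finset.mem_insert_of_mem hj))
      (fun j hj => h1 j (Finset.mem_insert_of_mem hj))
    have hsum : 0 ≤ ∑ j ∈ s, a j :=
      Finset.sum_nonneg fun j hj => h0 j (Finset.mem_insert_of_mem hj)
    have hi0 := h0 i (Finset.mem_insert_self i s)
    have hi1 := h1 i (Finset.mem_insert_self i s)
    nlinarith [mul_le_mul_of_nonneg_left ih' (sub_nonneg.2 hi1), mul_nonneg hi0 hsum]

/-- The `ℓ¹` distance of the indicator functions of two finite sets. -/
theorem tsum_abs_indicator_sub {α : Type*} [DecidableEq α] (s t : Finset α) :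
    ∑' x, |(if x ∈ s then (1 : ℝ) else 0) - (if x ∈ t then 1 else 0)|
      = s.card + t.card - 2 * (s ∩ t).card := by
  have h (x : α) : |(if x ∈ s then (1 : ℝ) else 0) - (if x ∈ t then 1 else 0)|
      = (if x ∈ s then 1 else 0) + (if x ∈ t then 1 else 0)
        - 2 * (if x ∈ s ∩ t then 1 else 0) := by
    by_cases hs : x ∈ s <;> by_cases ht : x ∈ t <;> (simp [hs, ht]; try norm_num)
  have hsupp : ∀ x ∉ s ∪ t,
      |(if x ∈ s then (1 : ℝ) else 0) - (if x ∈ t then 1 else 0)| = 0 := by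
    intro x hx
    rw [Finset.mem_union, not_or] at hx
    simp [hx.1, hx.2]
  have hst : (s ∪ t) ∩ (s ∩ t) = s ∩ t :=
    Finset.inter_eq_right.2 (Finset.inter_subset_left.trans Finset.subset_union_left)
  rw [tsum_eq_sum hsupp, Finset.sum_congr rfl fun x _ => h x, Finset.sum_sub_distrib,
    Finset.sum_add_distrib, ← Finset.mul_sum]
  simp only [Finset.sum_ite_mem, hst, Finset.union_inter_cancel_left,
    Finset.union_inter_cancel_right, Finset.sum_const, nsmul_eq_mul, mul_one]

/-- The number of integers in the intersection of `[-N, N)` with its translate by `c`. -/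
theorem card_Ico_inter_Ico_add (N : ℕ) (c : ℤ) (hc : |c| ≤ 2 * (N : ℤ)) :
    ((Finset.Ico (-(N : ℤ)) N ∩ Finset.Ico (-(N : ℤ) + c) (N + c)).card : ℝ)
      = 2 * N - |(c : ℝ)| := by
  have h : ((Finset.Ico (-(N : ℤ)) N ∩ Finset.Ico (-(N : ℤ) + c) (N + c)).card : ℤ)
      = 2 * N - |c| := by
    rw [Finset.Ico_inter_Ico, Int.card_Ico]
    grind
  exact_mod_cast h

/-- Shift bound for the uniform box distribution: translating the uniform
distribution on `{−N,…,N−1}ⁿ` by an integer vector `c` with `|cᵢ| ≤ 2N` changes it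
by at most `(∑ᵢ |cᵢ|)/(2N)` in total variation distance. -/
theorem uniform_box_shift_tv_bound (n N : ℕ) (hn : 1 ≤ n) (hN : 1 ≤ N)
    (c : Fin n → ℤ) (hc : ∀ i, |c i| ≤ 2 * (N : ℤ)) :
    (1 / 2) * ∑' x : Fin n → ℤ, |boxPdf n N x - boxPdf n N (x - c)|
      ≤ (∑ i, |(c i : ℝ)|) / (2 * (N : ℝ)) := by
  have hM : (0 : ℝ) < 2 * N := by positivity
  set s : Finset (Fin n → ℤ) := Fintype.piFinset fun _ => Finset.Ico (-(N : ℤ)) N with hs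
  set t : Finset (Fin n → ℤ) :=
    Fintype.piFinset fun i => Finset.Ico (-(N : ℤ) + c i) (N + c i) with ht
  have hbox (x : Fin n → ℤ) :
      boxPdf n N x = 1 / (2 * N : ℝ) ^ n * (if x ∈ s then 1 else 0) := by
    simp [boxPdf, hs, Fintype.mem_piFinset]
  have hmem (x : Fin n → ℤ) : x - c ∈ s ↔ x ∈ t := by
    simp only [hs, ht, Fintype.mem_piFinset, Finset.mem_Ico, Pi.sub_apply]
    exact forall_congr' fun i => by omega
  have habs (x : Fin n → ℤ) : |boxPdf n N x - boxPdf n N (x - c)|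
      = 1 / (2 * N : ℝ) ^ n *
        |(if x ∈ s then (1 : ℝ) else 0) - (if x ∈ t then 1 else 0)| := by
    simp only [hbox, hmem, ← mul_sub, abs_mul]
    rw [abs_of_pos (by positivity)]
  have hlen (a : ℤ) : ((Finset.Ico (-(N : ℤ) + a) (N + a)).card : ℝ) = 2 * N := by
    have h : ((Finset.Ico (-(N : ℤ) + a) (N + a)).card : ℤ) = 2 * N := by
      rw [Int.card_Ico]; omega
    exact_mod_cast h
  have hcs : (s.card : ℝ) = (2 * N) ^ n := by
    have := hlen 0
    simp only [add_zero] at this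
    rw [hs, Fintype.card_piFinset, Nat.cast_prod]
    simp only [this, Finset.prod_const, Finset.card_univ, Fintype.card_fin]
  have hct : (t.card : ℝ) = (2 * N) ^ n := by
    rw [ht, Fintype.card_piFinset, Nat.cast_prod]
    simp only [hlen, Finset.prod_const, Finset.card_univ, Fintype.card_fin]
  have hcst : ((s ∩ t).card : ℝ) = (2 * N) ^ n * ∏ i, (1 - |(c i : ℝ)| / (2 * N)) := by
    rw [hs, ht, ← Fintype.piFinset_inter, Fintype.card_piFinset, Nat.cast_prod]
    calc _ = ∏ i, (2 * N * (1 - |(c i : ℝ)| / (2 * N))) :=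
          Finset.prod_congr rfl fun i _ => by
            rw [card_Ico_inter_Ico_add N (c i) (hc i)]; field_simp
      _ = _ := by rw [Finset.prod_mul_distrib]; simp
  have hW := one_sub_sum_le_prod_one_sub_of_mem_unitInterval Finset.univ
    (fun i => |(c i : ℝ)| / (2 * N)) (fun i _ => by positivity)
    (fun i _ => (div_le_one hM).2 (by exact_mod_cast hc i))
  rw [← Finset.sum_div] at hW
  calc (1 / 2) * ∑' x : Fin n → ℤ, |boxPdf n N x - boxPdf n N (x - c)|
      = 1 - ∏ i, (1 - |(c i : ℝ)| / (2 * N)) := by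
        simp only [habs]
        rw [tsum_mul_left, tsum_abs_indicator_sub, hcs, hct, hcst]
        field_simp
        ring
    _ ≤ (∑ i, |(c i : ℝ)|) / (2 * (N : ℝ)) := by linarith
end
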